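/- For every ε ∈ (0, 1/2], liminf_{n→∞} E[L_n]/n ≥ 1/(1 + ε); in particular, the Chvátal–Sankoff constant γ(ε) = lim_{n→∞} E[L_n]/n (whose existence follows by subadditivity) satisfies γ(ε) ≥ 1/(1 + ε). -/

import Mathlib

open scoped BigOperators
open Classical

noncomputable section

/-- Length of a longest common subsequence of two boolean lists. -/
def lcsLen (x y : List Bool) : ℕ :=
  sSup {k : ℕ | ∃ z : List Bool, z.length = k ∧ z.Sublist x ∧ z.Sublist y}

/-- Bernoulli(ε) product weight of a binary string. -/
def wt (ε : ℝ) {n : ℕ} (x : Fin n → Bool) : ℝ :=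
  ∏ i, if x i then ε else 1 - ε

/-- Expectation of a function of two independent i.i.d. Bernoulli(ε) strings of length n. -/
def expec (ε : ℝ) (n : ℕ) (f : (Fin n → Bool) → (Fin n → Bool) → ℝ) : ℝ :=
  ∑ x : Fin n → Bool, ∑ y : Fin n → Bool, wt ε x * wt ε y * f x y

/-- LCS length of two binary strings of length n. -/
def Lcs {n : ℕ} (x y : Fin n → Bool) : ℕ := lcsLen (List.ofFn x) (List.ofFn y)

/-- Expectation of a function of one Bernoulli string of length `n`, seen as a list. -/
def Wx (ε : ℝ) (n : ℕ) (f : List Bool → ℝ) : ℝ :=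
  ∑ x : Fin n → Bool, wt ε x * f (List.ofFn x)

lemma Wx_zero (ε : ℝ) (f : List Bool → ℝ) : Wx ε 0 f = f [] := by
  simp [Wx, wt]

lemma Wx_succ (ε : ℝ) (n : ℕ) (f : List Bool → ℝ) :
    Wx ε (n+1) f = ε * Wx ε n (fun x => f (true :: x))
      + (1 - ε) * Wx ε n (fun x => f (false :: x)) := by
  unfold Wx
  rw [← (Fin.consEquiv (fun _ : Fin (n+1) => Bool)).sum_comp, Fintype.sum_prod_type]
  simp [wt, Fin.prod_univ_succ, Fin.consEquiv, List.ofFn_succ, Finset.mul_sum, mul_assoc]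

lemma Wx_add (ε : ℝ) (n : ℕ) (f g : List Bool → ℝ) :
    Wx ε n (fun x => f x + g x) = Wx ε n f + Wx ε n g := by
  simp [Wx, mul_add, Finset.sum_add_distrib]

lemma Wx_mul (ε : ℝ) (n : ℕ) (c : ℝ) (f : List Bool → ℝ) :
    Wx ε n (fun x => c * f x) = c * Wx ε n f := by
  simp only [Wx, Finset.mul_sum]
  exact Finset.sum_congr rfl fun x _ => by ring

lemma Wx_const (ε : ℝ) (n : ℕ) (c : ℝ) : Wx ε n (fun _ => c) = c := by
  induction n with
  | zero => simp [Wx_zero]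
  | succ n ih => rw [Wx_succ, ih]; ring

lemma wt_nonneg (ε : ℝ) (h0 : 0 ≤ ε) (h1 : ε ≤ 1) {n : ℕ} (x : Fin n → Bool) : 0 ≤ wt ε x := by
  unfold wt
  refine Finset.prod_nonneg fun i _ => ?_
  split_ifs <;> linarith

lemma Wx_mono (ε : ℝ) (h0 : 0 ≤ ε) (h1 : ε ≤ 1) (n : ℕ) {f g : List Bool → ℝ}
    (h : ∀ x, x.length = n → f x ≤ g x) : Wx ε n f ≤ Wx ε n g := by
  unfold Wx
  exact Finset.sum_le_sum fun x _ =>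
    mul_le_mul_of_nonneg_left (h _ (by simp)) (wt_nonneg ε h0 h1 x)

/-- Two-string expectation. -/
def Sx (ε : ℝ) (m k : ℕ) (f : List Bool → List Bool → ℝ) : ℝ :=
  Wx ε m (fun x => Wx ε k (fun y => f x y))

lemma Sx_succ_left (ε : ℝ) (m k : ℕ) (f : List Bool → List Bool → ℝ) :
    Sx ε (m+1) k f = ε * Sx ε m k (fun x y => f (true :: x) y)
      + (1 - ε) * Sx ε m k (fun x y => f (false :: x) y) := by
  unfold Sx; rw [Wx_succ]

lemma Sx_succ_right (ε : ℝ) (m k : ℕ) (f : List Bool → List Bool → ℝ) :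
    Sx ε m (k+1) f = ε * Sx ε m k (fun x y => f x (true :: y))
      + (1 - ε) * Sx ε m k (fun x y => f x (false :: y)) := by
  unfold Sx; simp only [Wx_succ, Wx_add, Wx_mul]

lemma Sx_mono (ε : ℝ) (h0 : 0 ≤ ε) (h1 : ε ≤ 1) (m k : ℕ) {f g : List Bool → List Bool → ℝ}
    (h : ∀ x y, x.length = m → y.length = k → f x y ≤ g x y) : Sx ε m k f ≤ Sx ε m k g :=
  Wx_mono ε h0 h1 m fun x hx => Wx_mono ε h0 h1 k fun y hy => h x y hx hy

lemma Sx_const (ε : ℝ) (m k : ℕ) (c : ℝ) : Sx ε m k (fun _ _ => c) = c := by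
  simp [Sx, Wx_const]

lemma Sx_one_add (ε : ℝ) (m k : ℕ) (f : List Bool → List Bool → ℝ) :
    Sx ε m k (fun x y => 1 + f x y) = 1 + Sx ε m k f := by
  simp [Sx, Wx_add, Wx_const]

lemma expec_eq (ε : ℝ) (n : ℕ) :
    expec ε n (fun x y => (Lcs x y : ℝ)) = Sx ε n n (fun x y => (lcsLen x y : ℝ)) := by
  simp [expec, Sx, Wx, Lcs, Finset.mul_sum, mul_assoc]

lemma lcs_bdd (x y : List Bool) :
    BddAbove {k : ℕ | ∃ z : List Bool, z.length = k ∧ z.Sublist x ∧ z.Sublist y} :=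
  ⟨x.length, by rintro k ⟨z, rfl, h, _⟩; exact h.length_le⟩

lemma lcs_mem (x y : List Bool) :
    ∃ z : List Bool, z.length = lcsLen x y ∧ z.Sublist x ∧ z.Sublist y :=
  Nat.sSup_mem (s := {k : ℕ | ∃ z : List Bool, z.length = k ∧ z.Sublist x ∧ z.Sublist y})
    ⟨0, [], by simp⟩ (lcs_bdd x y)

lemma le_lcs {x y z : List Bool} (h1 : z.Sublist x) (h2 : z.Sublist y) :
    z.length ≤ lcsLen x y :=
  le_csSup (lcs_bdd x y) ⟨z, rfl, h1, h2⟩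

lemma lcs_cons_cons (a : Bool) (x y : List Bool) :
    1 + (lcsLen x y : ℝ) ≤ lcsLen (a :: x) (a :: y) := by
  obtain ⟨z, hz, h1, h2⟩ := lcs_mem x y
  have := le_lcs (h1.cons₂ (a := a)) (h2.cons₂ (a := a))
  rw [List.length_cons, hz] at this
  have h : ((lcsLen x y + 1 : ℕ) : ℝ) ≤ lcsLen (a :: x) (a :: y) := by exact_mod_cast this
  push_cast at h; linarith

lemma lcs_cons_left (a : Bool) (x y : List Bool) :
    (lcsLen x y : ℝ) ≤ lcsLen (a :: x) y := by
  obtain ⟨z, hz, h1, h2⟩ := lcs_mem x y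
  have := le_lcs (h1.cons a) h2
  rw [hz] at this
  exact_mod_cast this

lemma lcs_cons_right (a : Bool) (x y : List Bool) :
    (lcsLen x y : ℝ) ≤ lcsLen x (a :: y) := by
  obtain ⟨z, hz, h1, h2⟩ := lcs_mem x y
  have := le_lcs h1 (h2.cons a)
  rw [hz] at this
  exact_mod_cast this

lemma lcs_le (x y : List Bool) : (lcsLen x y : ℝ) ≤ x.length := by
  obtain ⟨z, hz, h1, h2⟩ := lcs_mem x y
  rw [← hz]
  exact_mod_cast h1.length_le

def Gx (ε : ℝ) (m k : ℕ) : ℝ := Sx ε m k (fun x y => (lcsLen x y : ℝ))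
def HL (ε : ℝ) (m k : ℕ) : ℝ := Sx ε m k (fun x y => (lcsLen (false :: x) y : ℝ))
def HR (ε : ℝ) (m k : ℕ) : ℝ := Sx ε m k (fun x y => (lcsLen x (false :: y) : ℝ))

section
variable {ε : ℝ} (h0 : 0 ≤ ε) (h1 : ε ≤ 1)

lemma Sx_lcs_nonneg (h0 : 0 ≤ ε) (h1 : ε ≤ 1) (m k : ℕ) (p q : List Bool → List Bool) :
    0 ≤ Sx ε m k (fun x y => (lcsLen (p x) (q y) : ℝ)) := by
  rw [← Sx_const ε m k 0]
  exact Sx_mono ε h0 h1 m k fun x y _ _ => Nat.cast_nonneg _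

lemma HL_rec (h0 : 0 ≤ ε) (h1 : ε ≤ 1) (m k : ℕ) :
    ε * HL ε m k + (1 - ε) * (1 + Gx ε m k) ≤ HL ε m (k+1) := by
  unfold HL Gx
  rw [Sx_succ_right, ← Sx_one_add]
  have h2 : 0 ≤ 1 - ε := by linarith
  gcongr
  · exact Sx_mono ε h0 h1 m k fun x y _ _ => lcs_cons_right _ _ _
  · exact Sx_mono ε h0 h1 m k fun x y _ _ => lcs_cons_cons _ _ _

lemma HR_rec (h0 : 0 ≤ ε) (h1 : ε ≤ 1) (m k : ℕ) :
    ε * HR ε m k + (1 - ε) * (1 + Gx ε m k) ≤ HR ε (m+1) k := by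
  unfold HR Gx
  rw [Sx_succ_left, ← Sx_one_add]
  have h2 : 0 ≤ 1 - ε := by linarith
  gcongr
  · exact Sx_mono ε h0 h1 m k fun x y _ _ => lcs_cons_left _ _ _
  · exact Sx_mono ε h0 h1 m k fun x y _ _ => lcs_cons_cons _ _ _

lemma Gx_rec (h0 : 0 ≤ ε) (h1 : ε ≤ 1) (m k : ℕ) :
    ε * (ε * (1 + Gx ε m k) + (1 - ε) * HR ε m k)
      + (1 - ε) * (ε * HL ε m k + (1 - ε) * (1 + Gx ε m k)) ≤ Gx ε (m+1) (k+1) := by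
  unfold HR HL Gx
  rw [Sx_succ_left, Sx_succ_right, Sx_succ_right, ← Sx_one_add]
  have h2 : 0 ≤ 1 - ε := by linarith
  gcongr
  · exact Sx_mono ε h0 h1 m k fun x y _ _ => lcs_cons_cons _ _ _
  · exact Sx_mono ε h0 h1 m k fun x y _ _ => lcs_cons_left _ _ _
  · exact Sx_mono ε h0 h1 m k fun x y _ _ => lcs_cons_right _ _ _
  · exact Sx_mono ε h0 h1 m k fun x y _ _ => lcs_cons_cons _ _ _
end

/-- Quadratic potential argument; `s`, `r` are the parameters for the held states. -/
lemma key {ε δ a s r C : ℝ} (h0 : 0 ≤ ε) (h1 : ε ≤ 1) (hδ : 0 ≤ δ)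
    (hr : (1 - ε) * r = 2 * δ)
    (hs : a - δ + (1 - ε) * s + r ≤ 1 - ε)
    (ha : 2 * a ≤ ε ^ 2 + (1 - ε) ^ 2 + 2 * ε * (1 - ε) * s)
    (hC : ∀ t : ℝ, 0 ≤ t → a * t - δ * t ^ 2 - C ≤ 0)
    (hC' : ∀ t : ℝ, 0 ≤ t → a * t - δ * t ^ 2 - C + s - r * t ≤ 0) (N : ℕ) :
    ∀ m k : ℕ, m + k = N →
      a * (m + k) - δ * ((m : ℝ) - k) ^ 2 - C ≤ Gx ε m k ∧
      a * (m + k) - δ * ((m : ℝ) - k) ^ 2 - C + s - r * (m - k) ≤ HL ε m k ∧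
      a * (m + k) - δ * ((m : ℝ) - k) ^ 2 - C + s + r * (m - k) ≤ HR ε m k := by
  have h2 : 0 ≤ 1 - ε := by linarith
  induction N using Nat.strong_induction_on with
  | _ N ih =>
  intro m k hN
  refine ⟨?_, ?_, ?_⟩
  · rcases m with _ | m
    · have := hC k (by positivity)
      have h3 : 0 ≤ Gx ε 0 k := Sx_lcs_nonneg h0 h1 0 k id id
      push_cast; nlinarith
    rcases k with _ | k
    · have := hC (m+1) (by positivity)
      have h3 : 0 ≤ Gx ε (m+1) 0 := Sx_lcs_nonneg h0 h1 (m+1) 0 id id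
      push_cast; nlinarith
    obtain ⟨i1, i2, i3⟩ := ih (m + k) (by omega) m k rfl
    refine le_trans ?_ (Gx_rec h0 h1 m k)
    set P := a * ((m:ℝ) + k) - δ * ((m : ℝ) - k) ^ 2 - C with hP
    set d := r * ((m:ℝ) - k)
    calc _ = P + 2 * a := by rw [hP]; push_cast; ring
      _ ≤ ε * (ε * (1 + P) + (1 - ε) * (P + s + d))
        + (1 - ε) * (ε * (P + s - d) + (1 - ε) * (1 + P)) := by linarith
      _ ≤ _ := by gcongr
  · rcases k with _ | k
    · have := hC' m (by positivity)
      have h3 : 0 ≤ HL ε m 0 := Sx_lcs_nonneg h0 h1 m 0 (false :: ·) id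
      push_cast; nlinarith
    obtain ⟨i1, i2, i3⟩ := ih (m + k) (by omega) m k rfl
    refine le_trans ?_ (HL_rec h0 h1 m k)
    refine le_trans ?_ (add_le_add (mul_le_mul_of_nonneg_left i2 h0)
      (mul_le_mul_of_nonneg_left (add_le_add_right i1 1) h2))
    have e : (1 - ε) * r * ((m:ℝ) - k) = 2 * δ * ((m:ℝ) - k) := by rw [hr]
    push_cast; linarith
  · rcases m with _ | m
    · have := hC' k (by positivity)
      have h3 : 0 ≤ HR ε 0 k := Sx_lcs_nonneg h0 h1 0 k id (false :: ·)
      push_cast; nlinarith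
    obtain ⟨i1, i2, i3⟩ := ih (m + k) (by omega) m k rfl
    refine le_trans ?_ (HR_rec h0 h1 m k)
    refine le_trans ?_ (add_le_add (mul_le_mul_of_nonneg_left i3 h0)
      (mul_le_mul_of_nonneg_left (add_le_add_right i1 1) h2))
    have e : (1 - ε) * r * ((m:ℝ) - k) = 2 * δ * ((m:ℝ) - k) := by rw [hr]
    push_cast; linarith

lemma lower {ε δ : ℝ} (h0 : 0 < ε) (h1 : ε ≤ 1 / 2) (hδ : 0 < δ) :
    ∃ C : ℝ, ∀ n : ℕ, (1 - 3 * δ) / (1 + ε) * n - C ≤ Gx ε n n := by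
  set a := (1 - 3 * δ) / (2 * (1 + ε)) with ha
  have haeq : a * (2 * (1 + ε)) = 1 - 3 * δ := by rw [ha]; field_simp
  have h2 : (0:ℝ) < 1 - ε := by linarith
  set r := 2 * δ / (1 - ε) with hr
  have hreq : (1 - ε) * r = 2 * δ := by rw [hr]; field_simp
  have hr0 : 0 ≤ r := by positivity
  have hr4 : r ≤ 4 * δ := by rw [hr, div_le_iff₀ h2]; nlinarith
  set s := (1 - ε - a + δ - r) / (1 - ε) with hs
  have hseq : (1 - ε) * s = 1 - ε - a + δ - r := by rw [hs]; field_simp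
  set C := a ^ 2 / (4 * δ) + |s| with hC
  have q : ∀ t : ℝ, a * t - δ * t ^ 2 - a ^ 2 / (4 * δ) ≤ 0 := by
    intro t
    have : a * t - δ * t ^ 2 - a ^ 2 / (4 * δ) = - ((2 * δ * t - a) ^ 2 / (4 * δ)) := by
      field_simp; ring
    rw [this]; have : 0 ≤ (2 * δ * t - a) ^ 2 / (4 * δ) := by positivity
    linarith
  refine ⟨C, fun n => ?_⟩
  have := (key (a := a) (s := s) (r := r) (C := C) h0.le (by linarith) hδ.le hreq (by linarith)
    (by nlinarith) (fun t _ => by have := q t; have := abs_nonneg s; linarith)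
    (fun t ht => by
      have := q t; have := le_abs_self s; have := mul_nonneg hr0 ht; linarith) _ n n rfl).1
  have e : (1 - 3 * δ) / (1 + ε) = 2 * a := by rw [ha]; field_simp
  rw [e]
  simp only [sub_self] at this
  linarith

/-- For every ε ∈ (0, 1/2], liminf_{n→∞} E[L_n]/n ≥ 1/(1 + ε); in particular the
Chvátal–Sankoff constant γ(ε) = lim_n E[L_n]/n satisfies γ(ε) ≥ 1/(1 + ε). -/
theorem stmt6 (ε : ℝ) (hε : 0 < ε) (hε' : ε ≤ 1 / 2) :
    1 / (1 + ε) ≤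
      Filter.liminf (fun n : ℕ => expec ε n (fun x y => (Lcs x y : ℝ)) / n) Filter.atTop := by
  refine le_of_forall_lt fun b hb => ?_
  obtain ⟨b', hb1, hb2⟩ := exists_between hb
  refine lt_of_lt_of_le hb1 ?_
  have hup : ∀ n : ℕ, expec ε n (fun x y => (Lcs x y : ℝ)) / n ≤ 1 := by
    intro n
    refine div_le_one_of_le₀ ?_ (by positivity)
    rw [expec_eq]
    calc _ ≤ Sx ε n n (fun _ _ => (n : ℝ)) :=
          Sx_mono ε hε.le (by linarith) n n fun x y hx _ => by rw [← hx]; exact lcs_le x y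
      _ = n := Sx_const _ _ _ _
  refine Filter.le_liminf_of_le
    (Filter.isBoundedUnder_of ⟨1, fun n => hup n⟩).isCoboundedUnder_ge ?_
  obtain ⟨δ, hδ, hδb⟩ : ∃ δ : ℝ, 0 < δ ∧ b' < (1 - 3 * δ) / (1 + ε) := by
    rw [lt_div_iff₀ (by linarith)] at hb2
    refine ⟨(1 - b' * (1 + ε)) / 6, by linarith, ?_⟩
    rw [lt_div_iff₀ (by linarith)]
    linarith
  obtain ⟨C, hC⟩ := lower hε hε' hδ
  have hlim : Filter.Tendsto (fun n : ℕ => (1 - 3 * δ) / (1 + ε) - C / (n : ℝ)) Filter.atTop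
      (nhds ((1 - 3 * δ) / (1 + ε) - 0)) :=
    tendsto_const_nhds.sub (tendsto_const_div_atTop_nhds_zero_nat C)
  rw [sub_zero] at hlim
  filter_upwards [hlim.eventually_const_lt hδb, Filter.eventually_gt_atTop 0] with n hn hn0
  refine hn.le.trans ?_
  have hn' : (0:ℝ) < n := by exact_mod_cast hn0
  rw [expec_eq, le_div_iff₀ hn', sub_mul, div_mul_cancel₀ _ hn'.ne']
  exact hC n
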